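/- W is the disjoint union, over w ∈ W^J, of the sets [w]_J = W_J · (w W_{I(J,δ;w)}) = {δ(x) u x⁻¹ : x ∈ W_J, u ∈ w W_{I(J,δ;w)}}; that is, every element of W lies in exactly one set [w]_J with w ∈ W^J. -/

import Mathlib

namespace HePaper

variable {I : Type*} {M : CoxeterMatrix I} {W : Type*} [Group W]

/-- The standard parabolic subgroup `W_J` generated by the simple reflections `s_j`, `j ∈ J`. -/
def parabolic (cs : CoxeterSystem M W) (J : Set I) : Subgroup W :=
  Subgroup.closure (cs.simple '' J)

/-- `W^J`, the set of minimal length coset representatives for `W/W_J`. -/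
def minRight (cs : CoxeterSystem M W) (J : Set I) : Set W :=
  {w : W | ∀ j ∈ J, cs.length w < cs.length (w * cs.simple j)}

/-- `^J W`, the set of minimal length coset representatives for `W_J\W`. -/
def minLeft (cs : CoxeterSystem M W) (J : Set I) : Set W :=
  {w : W | ∀ j ∈ J, cs.length w < cs.length (cs.simple j * w)}

/-- `Ad(u)(K) = {k ∈ I : s_k = u s_j u⁻¹ for some j ∈ K}`. -/
def AdSet (cs : CoxeterSystem M W) (u : W) (K : Set I) : Set I :=
  {k : I | ∃ j ∈ K, cs.simple k = u * cs.simple j * u⁻¹}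

/-- Membership in the set `T(J, δ)` of sequences `(J_n, w_n)_{n ≥ 0}`. -/
def InT (cs : CoxeterSystem M W) (J : Set I) (δ : I ≃ I)
    (Jseq : ℕ → Set I) (wseq : ℕ → W) : Prop :=
  Jseq 0 = J ∧
  (∀ n : ℕ, Jseq (n + 1) = Jseq n ∩ AdSet cs (wseq n) (δ '' Jseq n)) ∧
  (∀ n : ℕ, wseq n ∈ minLeft cs (Jseq n) ∩ minRight cs (δ '' Jseq n)) ∧
  (∀ n : ℕ, ∃ x ∈ parabolic cs (Jseq (n + 1)), ∃ y ∈ parabolic cs (δ '' Jseq n),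
      wseq (n + 1) = x * wseq n * y)

/-- `I(J, δ; w)`: the largest subset `K ⊆ J` with `Ad(w)(K) = δ(K)`. -/
def IJdw (cs : CoxeterSystem M W) (J : Set I) (δ : I ≃ I) (w : W) : Set I :=
  ⋃₀ {K : Set I | K ⊆ J ∧ AdSet cs w K = δ '' K}

/-- The orbit of `w` under the `W_J`-action `x · y = δ(x) y x⁻¹`. -/
def orbit (cs : CoxeterSystem M W) (J : Set I) (δW : W ≃* W) (w : W) : Set W :=
  {y : W | ∃ x ∈ parabolic cs J, y = δW x * w * x⁻¹}

/-- The set of elements of minimal length in the orbit of `w`. -/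
def orbitMin (cs : CoxeterSystem M W) (J : Set I) (δW : W ≃* W) (w : W) : Set W :=
  {v ∈ orbit cs J δW w | ∀ u ∈ orbit cs J δW w, cs.length v ≤ cs.length u}

/-- `w →_{s_j} w'` for some `j ∈ J`: `w' = s_{δ(j)} w s_j` and `ℓ(w') ≤ ℓ(w)`. -/
def stepTo (cs : CoxeterSystem M W) (J : Set I) (δ : I ≃ I) (w w' : W) : Prop :=
  ∃ j ∈ J, w' = cs.simple (δ j) * w * cs.simple j ∧ cs.length w' ≤ cs.length w

/-- `w →_{J,δ} w'`. -/
def toRel (cs : CoxeterSystem M W) (J : Set I) (δ : I ≃ I) : W → W → Prop :=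
  Relation.ReflTransGen (stepTo cs J δ)

/-- `w` and `w'` are elementarily strongly `(J, δ)`-conjugate. -/
def ElemStrong (cs : CoxeterSystem M W) (J : Set I) (δW : W ≃* W) (w w' : W) : Prop :=
  cs.length w = cs.length w' ∧
  ∃ x ∈ parabolic cs J, w' = δW x * w * x⁻¹ ∧
    (cs.length (δW x * w) = cs.length x + cs.length w ∨
     cs.length (w * x⁻¹) = cs.length x + cs.length w)

/-- `w ∼_{J,δ} w'`: strongly `(J, δ)`-conjugate. -/
def simRel (cs : CoxeterSystem M W) (J : Set I) (δW : W ≃* W) : W → W → Prop :=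
  Relation.ReflTransGen (ElemStrong cs J δW)

/-- The Bruhat order on `W`: some reduced word for `w` contains a subword that is a
reduced word for `u`. -/
def bruhatLE (cs : CoxeterSystem M W) (u w : W) : Prop :=
  ∃ ω : List I, cs.wordProd ω = w ∧ cs.IsReduced ω ∧
    ∃ ω' : List I, ω'.Sublist ω ∧ cs.wordProd ω' = u ∧ cs.IsReduced ω'

/-- `supp(w)`: the smallest subset `K ⊆ I` with `w ∈ W_K`. -/
def supp (cs : CoxeterSystem M W) (w : W) : Set I :=
  ⋂₀ {K : Set I | w ∈ parabolic cs K}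

/-- `supp_δ(w)`: the smallest `δ`-stable subset of `I` containing `supp(w)`. -/
def suppDelta (cs : CoxeterSystem M W) (δ : I ≃ I) (w : W) : Set I :=
  ⋃ n : ℕ, (⇑δ)^[n] '' supp cs w

/-- `w ≤_{J,δ} w'` for `w, w' ∈ W^J`. -/
def leJd (cs : CoxeterSystem M W) (J : Set I) (δW : W ≃* W) (w w' : W) : Prop :=
  ∀ v' ∈ orbitMin cs J δW w', ∃ v ∈ orbitMin cs J δW w, bruhatLE cs v v'


section Geometric

open Polynomial.Chebyshev

/-- The linear form `v ↦ 2 B(e_i, v)` of the geometric representation. -/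
noncomputable def coroot (M : CoxeterMatrix I) (i : I) : Module.Dual ℝ (I →₀ ℝ) :=
  Finsupp.linearCombination ℝ (fun j => -2 * Real.cos (Real.pi / M i j))

lemma coroot_single (M : CoxeterMatrix I) (i j : I) :
    coroot M i (Finsupp.single j 1) = -2 * Real.cos (Real.pi / M i j) := by
  simp [coroot]

lemma coroot_self (M : CoxeterMatrix I) (i : I) :
    coroot M i (Finsupp.single i 1) = 2 := by
  simp [coroot_single]

/-- The reflections of the geometric representation. -/
noncomputable def geomReflection (M : CoxeterMatrix I) (i : I) : (I →₀ ℝ) ≃ₗ[ℝ] (I →₀ ℝ) :=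
  Module.reflection (coroot_self M i)

lemma eval_S_eq_zero {θ : ℝ} (hθ : Real.sin θ ≠ 0) (n : ℤ) (h : Real.sin ((n + 1) * θ) = 0) :
    (S ℝ n).eval (2 * Real.cos θ) = 0 := by
  have := S_two_mul_real_cos θ n
  rw [h] at this
  exact (mul_eq_zero.mp this).resolve_right hθ

lemma eval_S_add_eq_zero {θ : ℝ} (hθ : Real.sin θ ≠ 0) (n : ℤ)
    (h : (2 * n + 1) * θ = 2 * Real.pi) :
    (S ℝ n).eval (2 * Real.cos θ) + (S ℝ (n - 1)).eval (2 * Real.cos θ) = 0 := by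
  have h₁ := S_two_mul_real_cos θ n
  have h₂ := S_two_mul_real_cos θ (n - 1)
  refine (mul_eq_zero.mp (?_ : _ * Real.sin θ = 0)).resolve_right hθ
  rw [add_mul, h₁, h₂]
  have : ((n : ℝ) + 1) * θ = 2 * Real.pi - n * θ := by linarith
  rw [this, Real.sin_two_pi_sub]
  push_cast
  ring_nf

lemma geomReflection_isLiftable (M : CoxeterMatrix I) : M.IsLiftable (geomReflection M) := by
  intro i j
  rcases eq_or_ne i j with rfl | hij
  · rw [M.diagonal, pow_one]
    ext1 v
    exact Module.involutive_reflection (coroot_self M i) v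
  have hM1 := M.off_diagonal i j hij
  have hsymm : M j i = M i j := M.symmetric j i
  apply LinearEquiv.toLinearMap_injective
  have key := Module.reflection_mul_reflection_pow (coroot_self M i) (coroot_self M j) (M i j)
  have hf := coroot_single M i j
  have hg := coroot_single M j i
  rw [hsymm] at hg
  rw [geomReflection, geomReflection, key]
  generalize M.M i j = m at *
  rcases Nat.lt_or_ge m 3 with hm | hm
  · interval_cases m
    · simp
    · exact absurd rfl hM1
    · have : Real.cos (Real.pi / (2 : ℕ)) = 0 := by simp
      rw [this, mul_zero] at hf hg
      ext v
      simp [hf, hg]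
      ring
  set θ : ℝ := 2 * Real.pi / m with hθ
  have hm0 : (m : ℝ) ≠ 0 := by positivity
  have hmθ : m * θ = 2 * Real.pi := by rw [hθ]; field_simp
  have hsin : Real.sin θ ≠ 0 := by
    apply ne_of_gt
    apply Real.sin_pos_of_pos_of_lt_pi
    · positivity
    · rw [hθ, div_lt_iff₀ (by positivity)]
      have : (3 : ℝ) ≤ m := by exact_mod_cast hm
      nlinarith [Real.pi_pos]
  have ht : coroot M i (Finsupp.single j 1) * coroot M j (Finsupp.single i 1) - 2
      = 2 * Real.cos θ := by
    rw [hf, hg, hθ, show 2 * Real.pi / (m : ℝ) = 2 * (Real.pi / m) by ring, Real.cos_two_mul]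
    ring
  rw [ht]
  rcases Nat.even_or_odd' m with ⟨k, rfl | rfl⟩
  · have h₁ : (((2 * k : ℕ) : ℤ) - 2) / 2 = (k : ℤ) - 1 := by omega
    have h₂ : (((2 * k : ℕ) : ℤ) - 1) / 2 = (k : ℤ) - 1 := by omega
    have h₃ : (S ℝ ((k : ℤ) - 1)).eval (2 * Real.cos θ) = 0 := by
      apply eval_S_eq_zero hsin
      push_cast at hmθ ⊢
      rw [show ((k : ℝ) - 1 + 1) * θ = Real.pi by linarith, Real.sin_pi]
    rw [h₁, h₂, h₃]
    simp
  · have h₁ : (((2 * k + 1 : ℕ) : ℤ) - 2) / 2 = (k : ℤ) - 1 := by omega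
    have h₂ : (((2 * k + 1 : ℕ) : ℤ) - 1) / 2 = (k : ℤ) := by omega
    have h₃ : (((2 * k + 1 : ℕ) : ℤ) - 3) / 2 = (k : ℤ) - 1 := by omega
    have h₄ : ((2 * k + 1 : ℕ) : ℤ) / 2 = (k : ℤ) := by omega
    have h₅ := eval_S_add_eq_zero hsin (k : ℤ) (by push_cast at hmθ ⊢; exact hmθ)
    rw [h₁, h₂, h₃, h₄, h₅]
    simp

lemma simple_injective (cs : CoxeterSystem M W) : Function.Injective cs.simple := by
  intro i j h
  by_contra hij
  have h' : geomReflection M i = geomReflection M j := by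
    rw [← cs.lift_apply_simple (geomReflection_isLiftable M) i,
      ← cs.lift_apply_simple (geomReflection_isLiftable M) j, h]
  have h'' := congrArg (fun φ => φ (Finsupp.single i 1) i) h'
  simp [geomReflection, Module.reflection_apply, Ne.symm hij] at h''
  norm_num at h''

end Geometric

section Exchange

open Classical in
/-- The permutation of `W × ℤ/2` by which a simple reflection acts: it conjugates the first
coordinate and records in the second one whether that coordinate was the reflection itself. -/
noncomputable def signedConj (cs : CoxeterSystem M W) (i : I) : Equiv.Perm (W × ZMod 2) :=
  Function.Involutive.toPerm
    (fun p => (cs.simple i * p.1 * cs.simple i, p.2 + if p.1 = cs.simple i then 1 else 0)) <| by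
      rintro ⟨t, ε⟩
      have h : cs.simple i * t * cs.simple i = cs.simple i ↔ t = cs.simple i := by
        constructor
        · intro h
          have := congrArg (fun u => cs.simple i * u * cs.simple i) h
          simpa [mul_assoc] using this
        · rintro rfl
          simp
      ext
      · simp [mul_assoc]
      · simp only [h, add_assoc, CharTwo.add_self_eq_zero, add_zero]

open Classical in
lemma signedConj_apply (cs : CoxeterSystem M W) (i : I) (t : W) (ε : ZMod 2) :
    signedConj cs i (t, ε) =
      (cs.simple i * t * cs.simple i, ε + if t = cs.simple i then 1 else 0) := rfl

open Classical in
lemma signedConj_mul_pow_apply (cs : CoxeterSystem M W) (i j : I) (n : ℕ) (t : W) (ε : ZMod 2) :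
    ((signedConj cs i * signedConj cs j) ^ n) (t, ε) =
      ((cs.simple i * cs.simple j) ^ n * t * ((cs.simple i * cs.simple j) ^ n)⁻¹,
        ε + ∑ k ∈ Finset.range (2 * n),
          if (cs.simple i * cs.simple j) ^ k * t = cs.simple j then 1 else 0) := by
  induction n with
  | zero => simp
  | succ n ih =>
    rw [pow_succ', Equiv.Perm.mul_apply, ih, Equiv.Perm.mul_apply, signedConj_apply,
      signedConj_apply]
    set r := cs.simple i * cs.simple j with hr
    have hrj : ∀ k : ℕ, cs.simple j * r ^ k = (r ^ k)⁻¹ * cs.simple j := by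
      intro k
      have : cs.simple j * r * (cs.simple j)⁻¹ = r⁻¹ := by simp [hr, mul_assoc]
      have h2 := congrArg (· ^ k) this
      simp only [conj_pow, inv_pow] at h2
      rw [← h2]
      simp
    have e₁ : r ^ n * t * (r ^ n)⁻¹ = cs.simple j ↔ r ^ (2 * n) * t = cs.simple j := by
      rw [mul_inv_eq_iff_eq_mul, hrj, eq_inv_mul_iff_mul_eq, ← mul_assoc, ← pow_add, two_mul]
    have e₂ : cs.simple j * (r ^ n * t * (r ^ n)⁻¹) * cs.simple j = cs.simple i ↔
        r ^ (2 * n + 1) * t = cs.simple j := by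
      have h : cs.simple j * (cs.simple i * (cs.simple j * r ^ n)) =
          (r ^ (n + 1))⁻¹ * cs.simple j := by
        rw [← hrj, pow_succ', hr, mul_assoc (cs.simple i)]
      rw [show 2 * n + 1 = (n + 1) + n by omega, pow_add r (n + 1), mul_assoc (r ^ (n + 1)),
        ← eq_inv_mul_iff_mul_eq (b := r ^ (n + 1)), ← h]
      constructor
      · intro h
        simp [← h, mul_assoc]
      · intro h
        simp [h, mul_assoc]
    rw [Nat.mul_succ, Finset.sum_range_succ, Finset.sum_range_succ]
    simp only [e₁, e₂]
    ext
    · simp [hr, pow_succ', mul_assoc]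
    · simp [add_assoc]

lemma signedConj_isLiftable (cs : CoxeterSystem M W) : M.IsLiftable (signedConj cs) := by
  classical
  intro i j
  ext1 ⟨t, ε⟩
  rw [signedConj_mul_pow_apply, two_mul, Finset.sum_range_add]
  simp [pow_add, CharTwo.add_self_eq_zero]

open Classical in
lemma lift_signedConj_wordProd (cs : CoxeterSystem M W) (ω : List I) (t : W) (ε : ZMod 2) :
    cs.lift ⟨_, signedConj_isLiftable cs⟩ (cs.wordProd ω) (t, ε) =
      (cs.wordProd ω * t * (cs.wordProd ω)⁻¹, ε + (cs.rightInvSeq ω).count t) := by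
  induction ω with
  | nil => simp
  | cons i ω ih =>
    have e : cs.wordProd ω * t * (cs.wordProd ω)⁻¹ = cs.simple i ↔
        (cs.wordProd ω)⁻¹ * cs.simple i * cs.wordProd ω = t := by
      constructor
      · intro h; rw [← h]; group
      · intro h; rw [← h]; group
    rw [cs.wordProd_cons, map_mul, Equiv.Perm.mul_apply, ih, cs.lift_apply_simple,
      signedConj_apply]
    simp only [e, CoxeterSystem.rightInvSeq, List.count_cons, beq_iff_eq]
    ext
    · simp [mul_assoc]
    · push_cast
      simp [add_assoc]

/-- Whether a reflection occurs an odd number of times in the right inversion sequence of a word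
depends only on the product of the word. -/
lemma count_rightInvSeq_congr [DecidableEq W] (cs : CoxeterSystem M W) {ω ω' : List I}
    (h : cs.wordProd ω = cs.wordProd ω') (t : W) :
    ((cs.rightInvSeq ω).count t : ZMod 2) = (cs.rightInvSeq ω').count t := by
  have h₁ := lift_signedConj_wordProd cs ω t 0
  rw [h, lift_signedConj_wordProd] at h₁
  have := congrArg Prod.snd h₁
  simp only [zero_add] at this
  convert this.symm

/-- The exchange property. -/
lemma exists_eraseIdx_of_isRightDescent (cs : CoxeterSystem M W) {ω : List I} {i : I}
    (h : cs.IsRightDescent (cs.wordProd ω) i) :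
    ∃ k < ω.length, cs.wordProd ω * cs.simple i = cs.wordProd (ω.eraseIdx k) := by
  classical
  obtain ⟨α, hα, hαω⟩ := cs.exists_isReduced (cs.wordProd ω * cs.simple i)
  have hω : cs.wordProd ω = cs.wordProd (α.concat i) := by
    rw [cs.wordProd_concat, ← hαω]; simp
  have hnot : cs.simple i ∉ cs.rightInvSeq α := by
    intro hmem
    have := (cs.isRightInversion_of_mem_rightInvSeq hα hmem).2
    rw [← hαω] at this
    simp only [CoxeterSystem.simple_mul_simple_cancel_right] at this
    exact lt_asymm this h
  have hcount := count_rightInvSeq_congr cs hω (cs.simple i)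
  have hfix : MulAut.conj (cs.simple i) (cs.simple i) = cs.simple i := by simp
  have hnot' : cs.simple i ∉ (cs.rightInvSeq α).map (MulAut.conj (cs.simple i)) := by
    rw [List.mem_map]
    rintro ⟨u, hu, hui⟩
    exact hnot ((MulAut.conj (cs.simple i)).injective (hui.trans hfix.symm) ▸ hu)
  rw [cs.rightInvSeq_concat, List.concat_eq_append, List.count_append,
    List.count_eq_zero_of_not_mem hnot', List.count_singleton_self] at hcount
  have hmem : cs.simple i ∈ cs.rightInvSeq ω := by
    by_contra hc
    rw [List.count_eq_zero_of_not_mem hc] at hcount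
    exact absurd hcount (by decide)
  obtain ⟨k, hk, hk'⟩ := List.mem_iff_getElem.mp hmem
  refine ⟨k, by simpa using hk, ?_⟩
  rw [← cs.wordProd_mul_getD_rightInvSeq, List.getD_eq_getElem _ 1 hk, hk']

end Exchange

section Parabolic

lemma mem_parabolic_iff (cs : CoxeterSystem M W) {J : Set I} {u : W} :
    u ∈ parabolic cs J ↔ ∃ ω : List I, (∀ j ∈ ω, j ∈ J) ∧ cs.wordProd ω = u := by
  constructor
  · intro hu
    induction hu using Subgroup.closure_induction with
    | mem x hx =>
      obtain ⟨j, hj, rfl⟩ := hx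
      exact ⟨[j], by simpa using hj, by simp⟩
    | one => exact ⟨[], by simp, by simp⟩
    | mul x y _ _ hx hy =>
      obtain ⟨ω, hω, rfl⟩ := hx
      obtain ⟨ω', hω', rfl⟩ := hy
      refine ⟨ω ++ ω', fun j hj => ?_, cs.wordProd_append ω ω'⟩
      exact (List.mem_append.mp hj).elim (hω j) (hω' j)
    | inv x _ hx =>
      obtain ⟨ω, hω, rfl⟩ := hx
      exact ⟨ω.reverse, by simpa using hω, cs.wordProd_reverse ω⟩
  · rintro ⟨ω, hω, rfl⟩
    refine Subgroup.list_prod_mem _ fun x hx => ?_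
    obtain ⟨j, hj, rfl⟩ := List.mem_map.mp hx
    exact Subgroup.subset_closure ⟨j, hω j hj, rfl⟩

lemma one_mem_minRight (cs : CoxeterSystem M W) (J : Set I) : (1 : W) ∈ minRight cs J :=
  fun j _ => by simp

/-- Deodhar's lemma. -/
lemma simple_mul_mem_minRight_or (cs : CoxeterSystem M W) {J : Set I} {w : W}
    (hw : w ∈ minRight cs J) (i : I) :
    cs.simple i * w ∈ minRight cs J ∨ ∃ j ∈ J, cs.simple i * w = w * cs.simple j := by
  by_contra! hcon
  obtain ⟨hmem, hne⟩ := hcon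
  simp only [minRight, Set.mem_ofPred_eq, not_forall, not_lt] at hmem
  obtain ⟨j, hj, hle⟩ := hmem
  obtain ⟨ω, hω, rfl⟩ := cs.exists_isReduced w
  rw [← cs.wordProd_cons] at hle
  obtain ⟨k, hk, hk'⟩ := exists_eraseIdx_of_isRightDescent cs
    (lt_of_le_of_ne hle (cs.length_mul_simple_ne (cs.wordProd (i :: ω)) j))
  rw [cs.wordProd_cons] at hk'
  cases k with
  | zero =>
    apply hne j hj
    rw [List.eraseIdx_cons_zero] at hk'
    rw [← hk', cs.simple_mul_simple_cancel_right, hk']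
  | succ k =>
    rw [List.eraseIdx_cons_succ, cs.wordProd_cons, mul_assoc, mul_left_cancel_iff] at hk'
    have h₁ := hw j hj
    have h₂ := cs.length_wordProd_le (ω.eraseIdx k)
    have h₃ := List.length_eraseIdx_add_one (l := ω) (i := k) (by simpa using hk)
    rw [hk', hω.eq] at h₁
    omega

/-- Moving a word past a minimal coset representative `w` yields a word in `J` that is strictly
shorter, unless every letter commutes past `w`. -/
lemma exists_wordProd_mul_eq (cs : CoxeterSystem M W) {J : Set I} {w : W}
    (hw : w ∈ minRight cs J) (ω : List I) :
    ∃ w' ∈ minRight cs J, ∃ ω' : List I, (∀ j ∈ ω', j ∈ J) ∧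
      cs.wordProd ω * w = w' * cs.wordProd ω' ∧
      (ω'.length < ω.length ∨
        w' = w ∧ List.Forall₂ (fun i j => cs.simple i * w = w * cs.simple j) ω ω') := by
  induction ω with
  | nil => exact ⟨w, hw, [], by simp, by simp, Or.inr ⟨rfl, .nil⟩⟩
  | cons i ω ih =>
    obtain ⟨w', hw', ω', hω', heq, h⟩ := ih
    have hle : ω'.length ≤ ω.length := h.elim le_of_lt fun h => h.2.length_eq.ge
    rcases simple_mul_mem_minRight_or cs hw' i with hi | ⟨j, hj, hij⟩
    · refine ⟨_, hi, ω', hω', ?_, Or.inl (Nat.lt_succ_of_le hle)⟩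
      rw [cs.wordProd_cons, mul_assoc, heq, mul_assoc]
    · refine ⟨w', hw', j :: ω', List.forall_mem_cons.mpr ⟨hj, hω'⟩, ?_, ?_⟩
      · rw [cs.wordProd_cons, mul_assoc, heq, ← mul_assoc, hij, mul_assoc, ← cs.wordProd_cons]
      · rcases h with h | ⟨rfl, h⟩
        · exact Or.inl (Nat.succ_lt_succ h)
        · exact Or.inr ⟨rfl, .cons hij h⟩

lemma exists_eq_minRight_mul_wordProd (cs : CoxeterSystem M W) (J : Set I) (y : W) :
    ∃ w ∈ minRight cs J, ∃ ω : List I, (∀ j ∈ ω, j ∈ J) ∧ y = w * cs.wordProd ω := by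
  obtain ⟨α, rfl⟩ := cs.wordProd_surjective y
  obtain ⟨w, hw, ω, hω, h, -⟩ := exists_wordProd_mul_eq cs (one_mem_minRight cs J) α
  exact ⟨w, hw, ω, hω, by simpa using h⟩

lemma mul_wordProd_eq_self_of_mem_minRight (cs : CoxeterSystem M W) {J : Set I} {w : W}
    (hmin : ∀ u ∈ parabolic cs J, cs.length w ≤ cs.length (w * u)) (ω : List I)
    (hω : ∀ j ∈ ω, j ∈ J) (h : w * cs.wordProd ω ∈ minRight cs J) : w * cs.wordProd ω = w := by
  induction hn : ω.length using Nat.strong_induction_on generalizing ω with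
  | _ n ih =>
  subst hn
  rcases List.eq_nil_or_concat ω with rfl | ⟨ω, i, rfl⟩
  · simp
  have hi : i ∈ J := hω i (by simp)
  have hωJ : ∀ j ∈ ω, j ∈ J := fun j hj => hω j (by simp [hj])
  obtain ⟨α, hα, rfl⟩ := cs.exists_isReduced w
  have hlt := h i hi
  rw [cs.wordProd_concat, ← mul_assoc, cs.simple_mul_simple_cancel_right,
    ← cs.wordProd_append] at hlt
  obtain ⟨k, hk, hk'⟩ := exists_eraseIdx_of_isRightDescent cs hlt
  rcases lt_or_ge k α.length with hkα | hkα
  · rw [List.eraseIdx_append_of_lt_length hkα, cs.wordProd_append, cs.wordProd_append] at hk'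
    have hmem := mul_mem (mul_mem ((mem_parabolic_iff cs).mpr ⟨ω, hωJ, rfl⟩)
      (Subgroup.subset_closure ⟨i, hi, rfl⟩))
      (inv_mem ((mem_parabolic_iff cs).mpr ⟨ω, hωJ, rfl⟩))
    have h₁ := hmin _ hmem
    rw [← mul_assoc, ← mul_assoc, hk', mul_inv_cancel_right, hα.eq] at h₁
    have h₂ := cs.length_wordProd_le (α.eraseIdx k)
    have h₃ := List.length_eraseIdx_add_one hkα
    omega
  · rw [List.eraseIdx_append_of_length_le hkα, cs.wordProd_append, cs.wordProd_append,
      mul_assoc, ← cs.wordProd_concat] at hk'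
    rw [hk'] at h ⊢
    have h₃ := List.length_eraseIdx_add_one (l := ω) (i := k - α.length)
      (by rw [List.length_append] at hk; omega)
    exact ih _ (by simp; omega) _ (fun j hj => hωJ j (List.mem_of_mem_eraseIdx hj)) h rfl

/-- A coset of `W_J` contains only one element of `W^J`. -/
lemma eq_of_mem_minRight (cs : CoxeterSystem M W) {J : Set I} {w w' : W}
    (hw : w ∈ minRight cs J) (hw' : w' ∈ minRight cs J) (h : w⁻¹ * w' ∈ parabolic cs J) :
    w = w' := by
  obtain ⟨u, hu, hmin⟩ : ∃ u ∈ parabolic cs J, ∀ v ∈ parabolic cs J,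
      cs.length (w * u) ≤ cs.length (w * v) := by
    have hne : {n | ∃ u ∈ parabolic cs J, cs.length (w * u) = n}.Nonempty := ⟨_, 1, one_mem _, rfl⟩
    obtain ⟨u, hu, hlen⟩ := Nat.sInf_mem hne
    exact ⟨u, hu, fun v hv => hlen ▸ Nat.sInf_le ⟨v, hv, rfl⟩⟩
  have key : ∀ z ∈ minRight cs J, w⁻¹ * z ∈ parabolic cs J → z = w * u := by
    intro z hz hwz
    obtain ⟨ω, hω, heq⟩ := (mem_parabolic_iff cs).mp (mul_mem (inv_mem hu) hwz)
    have hz' : w * u * cs.wordProd ω = z := by rw [heq]; group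
    rw [← hz']
    refine mul_wordProd_eq_self_of_mem_minRight cs (fun v hv => ?_) ω hω (hz' ▸ hz)
    rw [mul_assoc]
    exact hmin _ (mul_mem hu hv)
  rw [key w hw (by simp), key w' hw' h]

end Parabolic

section Pieces

lemma map_wordProd (cs : CoxeterSystem M W) {δ : I ≃ I} {δW : W ≃* W}
    (hδW : ∀ i : I, δW (cs.simple i) = cs.simple (δ i)) (ω : List I) :
    δW (cs.wordProd ω) = cs.wordProd (ω.map δ) := by
  induction ω with
  | nil => simp
  | cons i ω ih => rw [cs.wordProd_cons, map_mul, hδW, ih, List.map_cons, cs.wordProd_cons]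

lemma IJdw_subset (cs : CoxeterSystem M W) (J : Set I) (δ : I ≃ I) (w : W) :
    IJdw cs J δ w ⊆ J :=
  Set.sUnion_subset fun _ hK => hK.1

lemma conj_map_mem_parabolic_IJdw (cs : CoxeterSystem M W) {J : Set I} {δ : I ≃ I}
    {δW : W ≃* W} (hδW : ∀ i : I, δW (cs.simple i) = cs.simple (δ i)) {w v : W}
    (hv : v ∈ parabolic cs (IJdw cs J δ w)) :
    w⁻¹ * δW v * w ∈ parabolic cs (IJdw cs J δ w) := by
  induction hv using Subgroup.closure_induction with
  | mem x hx =>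
    obtain ⟨i, ⟨K, hK, hi⟩, rfl⟩ := hx
    have : δ i ∈ AdSet cs w K := hK.2 ▸ Set.mem_image_of_mem δ hi
    obtain ⟨j, hj, hij⟩ := this
    rw [hδW, hij]
    have : w⁻¹ * (w * cs.simple j * w⁻¹) * w = cs.simple j := by group
    rw [this]
    exact Subgroup.subset_closure ⟨j, ⟨K, hK, hj⟩, rfl⟩
  | one => simp
  | mul x y _ _ hx hy =>
    have := mul_mem hx hy
    simpa [mul_assoc] using this
  | inv x _ hx =>
    have := inv_mem hx
    simpa [mul_assoc] using this

lemma eq_of_orbit_eq (cs : CoxeterSystem M W) {J : Set I} {δ : I ≃ I} {δW : W ≃* W}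
    (hδW : ∀ i : I, δW (cs.simple i) = cs.simple (δ i)) {w w' : W}
    (hw : w ∈ minRight cs J) (hw' : w' ∈ minRight cs J) (ω : List I) (hω : ∀ j ∈ ω, j ∈ J)
    {v v' : W} (hv : v ∈ parabolic cs (IJdw cs J δ w)) (hv' : v' ∈ parabolic cs (IJdw cs J δ w'))
    (h : w' * v' = δW (cs.wordProd ω) * (w * v) * (cs.wordProd ω)⁻¹) : w = w' := by
  induction hn : ω.length using Nat.strong_induction_on generalizing ω v v' with
  | _ n ih =>
  subst hn
  obtain ⟨w₁, hw₁, ω', hω', heq, hcase⟩ := exists_wordProd_mul_eq cs hw (ω.map δ)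
  rw [← map_wordProd cs hδW] at heq
  have hsub : ∀ z, parabolic cs (IJdw cs J δ z) ≤ parabolic cs J := fun z =>
    Subgroup.closure_mono (Set.image_mono (IJdw_subset cs J δ z))
  have hx : cs.wordProd ω ∈ parabolic cs J := (mem_parabolic_iff cs).mpr ⟨ω, hω, rfl⟩
  have hu : cs.wordProd ω' ∈ parabolic cs J := (mem_parabolic_iff cs).mpr ⟨ω', hω', rfl⟩
  generalize cs.wordProd ω = x at *
  have h₁ : w' * v' = w₁ * (cs.wordProd ω' * v * x⁻¹) := by
    rw [h, ← mul_assoc, heq]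
    group
  have hww : w₁ = w' := by
    apply eq_of_mem_minRight cs hw₁ hw'
    have : w₁⁻¹ * w' = cs.wordProd ω' * v * x⁻¹ * v'⁻¹ := by
      rw [eq_mul_inv_iff_mul_eq, mul_assoc, h₁, inv_mul_cancel_left]
    rw [this]
    exact mul_mem (mul_mem (mul_mem hu (hsub w hv)) (inv_mem hx)) (inv_mem (hsub w' hv'))
  subst hww
  rcases hcase with hlt | ⟨hww, -⟩
  · rw [List.length_map] at hlt
    refine ih _ hlt ω' hω' (conj_map_mem_parabolic_IJdw cs hδW hv)
      (conj_map_mem_parabolic_IJdw cs hδW hv') ?_ rfl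
    rw [mul_left_cancel h₁, map_mul, map_mul, map_inv,
      eq_mul_inv_of_mul_eq heq.symm]
    group
  · exact hww.symm

lemma subset_IJdw (cs : CoxeterSystem M W) [Finite I] {J K : Set I} {δ : I ≃ I} {w : W}
    (hKJ : K ⊆ J) (h : ∀ i ∈ K, ∃ j ∈ K, cs.simple (δ i) * w = w * cs.simple j) :
    K ⊆ IJdw cs J δ w := by
  refine Set.subset_sUnion_of_mem ⟨hKJ, ?_⟩
  choose! f hfK hf using h
  have hinj : Set.InjOn f K := by
    intro i hi i' hi' hii
    have := (hf i hi).trans (hii ▸ (hf i' hi').symm)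
    exact δ.injective (simple_injective cs (mul_right_cancel this))
  have hsurj : Set.SurjOn f K K := by
    refine (Set.eq_of_subset_of_ncard_le (Set.image_subset_iff.mpr hfK) ?_ (Set.toFinite K)).ge
    rw [hinj.ncard_image]
  ext k
  constructor
  · rintro ⟨j, hj, hk⟩
    obtain ⟨i, hi, rfl⟩ := hsurj hj
    rw [← hf i hi, mul_inv_cancel_right] at hk
    exact ⟨i, hi, (simple_injective cs hk).symm⟩
  · rintro ⟨i, hi, rfl⟩
    exact ⟨f i, hfK i hi, eq_mul_inv_of_mul_eq (hf i hi)⟩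

lemma exists_mem_piece (cs : CoxeterSystem M W) [Finite I] (J : Set I) {δ : I ≃ I} {δW : W ≃* W}
    (hδW : ∀ i : I, δW (cs.simple i) = cs.simple (δ i)) (y : W) :
    ∃ w ∈ minRight cs J, ∃ x ∈ parabolic cs J, ∃ v ∈ parabolic cs (IJdw cs J δ w),
      y = δW x * (w * v) * x⁻¹ := by
  let P : W → List I → Prop := fun w ω => (∀ j ∈ ω, j ∈ J) ∧
    ∃ x ∈ parabolic cs J, y = δW x * (w * cs.wordProd ω) * x⁻¹
  have hne : {n | ∃ w ∈ minRight cs J, ∃ ω, P w ω ∧ ω.length = n}.Nonempty := by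
    obtain ⟨w, hw, ω, hω, h⟩ := exists_eq_minRight_mul_wordProd cs J y
    exact ⟨_, w, hw, ω, ⟨hω, 1, one_mem _, by simpa using h⟩, rfl⟩
  obtain ⟨w, hw, ω, hω, hlen⟩ := Nat.sInf_mem hne
  have hmin : ∀ w' ∈ minRight cs J, ∀ ω', P w' ω' → ω.length ≤ ω'.length :=
    fun w' hw' ω' h => hlen ▸ Nat.sInf_le ⟨w', hw', ω', h, rfl⟩
  clear hlen
  have hstep : ∀ α, P w α → α.length = ω.length → ∃ β, P w β ∧ β.length = ω.length ∧
      List.Forall₂ (fun i j => cs.simple (δ i) * w = w * cs.simple j) α β := by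
    rintro α ⟨hα, x, hx, rfl⟩ hlen
    obtain ⟨w', hw', β, hβ, heq, hcase⟩ := exists_wordProd_mul_eq cs hw (α.map δ)
    rw [← map_wordProd cs hδW] at heq
    have hP : P w' β := by
      refine ⟨hβ, x * (cs.wordProd α)⁻¹,
        mul_mem hx (inv_mem ((mem_parabolic_iff cs).mpr ⟨α, hα, rfl⟩)), ?_⟩
      rw [← heq, map_mul, map_inv]
      group
    rcases hcase with hlt | ⟨rfl, hfor⟩
    · have := hmin w' hw' β hP
      rw [List.length_map] at hlt
      omega
    · rw [List.forall₂_map_left_iff] at hfor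
      exact ⟨β, hP, hfor.length_eq.symm.trans hlen, hfor⟩
  let K : Set I := {i | ∃ α, P w α ∧ α.length = ω.length ∧ i ∈ α}
  have hK : K ⊆ IJdw cs J δ w := by
    apply subset_IJdw cs
    · rintro i ⟨α, hα, -, hi⟩
      exact hα.1 i hi
    · rintro i ⟨α, hα, hlen, hi⟩
      obtain ⟨β, hβ, hlenβ, hfor⟩ := hstep α hα hlen
      obtain ⟨k, hk, rfl⟩ := List.mem_iff_getElem.mp hi
      have hkβ : k < β.length := by omega
      exact ⟨β[k], ⟨β, hβ, hlenβ, List.getElem_mem hkβ⟩, hfor.get hk hkβ⟩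
  obtain ⟨x, hx, hy⟩ := hω.2
  exact ⟨w, hw, x, hx, _,
    (mem_parabolic_iff cs).mpr ⟨ω, fun j hj => hK ⟨ω, hω, rfl, hj⟩, rfl⟩, hy⟩

end Pieces

/-- `W` is the disjoint union over `w ∈ W^J` of the sets
`[w]_J = {δ(x) u x⁻¹ : x ∈ W_J, u ∈ w W_{I(J,δ;w)}}`. -/
theorem partition_into_pieces
    [Fintype I] [Finite W]
    (cs : CoxeterSystem M W) (J : Set I) (δ : I ≃ I)
    (hδM : ∀ i j : I, M (δ i) (δ j) = M i j)
    (δW : W ≃* W) (hδW : ∀ i : I, δW (cs.simple i) = cs.simple (δ i)) :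
    ∀ y : W, ∃! w : W, w ∈ minRight cs J ∧
      ∃ x ∈ parabolic cs J, ∃ v ∈ parabolic cs (IJdw cs J δ w),
        y = δW x * (w * v) * x⁻¹ := by
  intro y
  obtain ⟨w, hw, x, hx, v, hv, hy⟩ := exists_mem_piece cs J hδW y
  refine ⟨w, ⟨hw, x, hx, v, hv, hy⟩, ?_⟩
  rintro w' ⟨hw', x', hx', v', hv', hy'⟩
  obtain ⟨ω, hω, hωx⟩ := (mem_parabolic_iff cs).mp (mul_mem (inv_mem hx') hx)
  refine (eq_of_orbit_eq cs hδW hw hw' ω hω hv hv' ?_).symm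
  rw [hωx, map_mul, map_inv]
  have : w' * v' = (δW x')⁻¹ * y * x' := by rw [hy']; group
  rw [this, hy]
  group

end HePaper
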